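/- Let A_1, …, A_m be a finite measurable partition of M into pairwise disjoint sets, and suppose that for each j there is a constant d_j ∈ ℝ^n with d(X, τ) = d_j for all X ∈ S(A_j). Assume in addition that the second moments of the displacement grow diffusively with diffusion coefficient D ≥ 0 at the two times t and t+τ: ∫_M d_a(X, s) d_b(X, s) dν(X) = 2 D s ν(M) δ_{ab} for s = t and s = t + τ and all a, b ∈ {1, …, n}. Then ∑_{j=1}^m [ d_{j,a} T_t(A_j)_b + T_t(A_j)_a d_{j,b} + ν(A_j) d_{j,a} d_{j,b} ] = 2 D τ ν(M) δ_{ab} for all a, b. (This is the fundamental sum rule, Eq. (sumrule*) of the paper, relating the diffusion coefficient to the first coefficients T(A_j) of the wave-number expansion of the hydrodynamic measures.) -/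

import Mathlib

open MeasureTheory

/-- the fundamental sum rule Eq. (sumrule*). If moreover the
second moments of the displacement grow diffusively with diffusion coefficient
`D ≥ 0` at the two times `t` and `t+τ`, then
`∑_j [ d_{j,a} T_t(A_j)_b + T_t(A_j)_a d_{j,b} + ν(A_j) d_{j,a} d_{j,b} ]
  = 2 D τ ν(M) δ_{ab}`. -/
theorem fundamental_sum_rule {M : Type*} [MeasurableSpace M]
    (ν : Measure M) [IsFiniteMeasure ν] (hν : 0 < ν Set.univ)
    {n : ℕ} (hn : 1 ≤ n) (d : M → ℝ → Fin n → ℝ)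
    (hdmeas : ∀ s : ℝ, Measurable fun X => d X s)
    (hdbd : ∀ s : ℝ, ∃ C : ℝ, ∀ X : M, ‖d X s‖ ≤ C)
    (S : M ≃ M) (hS : MeasurePreserving S ν ν) (hS' : MeasurePreserving S.symm ν ν)
    (τ : ℝ)
    (hcocycle : ∀ (X : M) (t : ℝ), d X (t + τ) = d X τ + d (S.symm X) t)
    (m : ℕ) (A : Fin m → Set M)
    (hAmeas : ∀ j, MeasurableSet (A j))
    (hAdisj : ∀ i j, i ≠ j → Disjoint (A i) (A j))
    (hAcover : (⋃ j, A j) = Set.univ)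
    (dj : Fin m → Fin n → ℝ)
    (hdj : ∀ j, ∀ X ∈ S '' A j, d X τ = dj j)
    (t : ℝ) (D : ℝ) (hD : 0 ≤ D)
    (hdiffusive : ∀ s ∈ ({t, t + τ} : Set ℝ), ∀ a b : Fin n,
      (∫ X, d X s a * d X s b ∂ν)
        = 2 * D * s * (ν Set.univ).toReal * (if a = b then 1 else 0)) :
    ∀ a b : Fin n,
      (∑ j, (dj j a * (∫ X in A j, d X t b ∂ν)
              + (∫ X in A j, d X t a ∂ν) * dj j b
              + (ν (A j)).toReal * dj j a * dj j b))
        = 2 * D * τ * (ν Set.univ).toReal * (if a = b then 1 else 0) := by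
  intro a b
  let e : M ≃ᵐ M := ⟨S, hS.measurable, hS'.measurable⟩
  have he : MeasurePreserving e ν ν := hS
  have hm : ∀ s c, Measurable fun X => d X s c := fun s c =>
    (measurable_pi_apply c).comp (hdmeas s)
  have hint : ∀ c, Integrable (fun X => d X t c) ν := by
    intro c
    obtain ⟨C, hC⟩ := hdbd t
    exact Integrable.of_bound (hm t c).aestronglyMeasurable C
      (Filter.Eventually.of_forall fun X => (norm_le_pi_norm (d X t) c).trans (hC X))
  have hint2 : ∀ s, Integrable (fun X => d X s a * d X s b) ν := by
    intro s
    obtain ⟨C, hC⟩ := hdbd s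
    refine Integrable.of_bound ((hm s a).mul (hm s b)).aestronglyMeasurable (C * C)
      (Filter.Eventually.of_forall fun X => ?_)
    have h1 := (norm_le_pi_norm (d X s) a).trans (hC X)
    have h2 := (norm_le_pi_norm (d X s) b).trans (hC X)
    rw [norm_mul]
    exact mul_le_mul h1 h2 (norm_nonneg _) ((norm_nonneg _).trans h1)
  have split : ∀ f : M → ℝ, Integrable f ν → ∫ X, f X ∂ν = ∑ j, ∫ X in A j, f X ∂ν := by
    intro f hf
    rw [← setIntegral_univ, ← hAcover]
    exact integral_iUnion_fintype hAmeas (fun i j h => hAdisj i j h)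
      (fun j => hf.integrableOn)
  have h1 := hdiffusive t (by simp) a b
  have h2 := hdiffusive (t + τ) (by simp) a b
  have h3 := he.integral_comp' (fun X => d X (t + τ) a * d X (t + τ) b)
  have hi3 : Integrable (fun X => d (e X) (t + τ) a * d (e X) (t + τ) b) ν :=
    he.integrable_comp_of_integrable (hint2 (t + τ))
  rw [← h3, split _ hi3] at h2
  rw [split _ (hint2 t)] at h1
  have key : ∀ j, ∫ X in A j, d (e X) (t + τ) a * d (e X) (t + τ) b ∂ν
      = (dj j a * (∫ X in A j, d X t b ∂ν)
              + (∫ X in A j, d X t a ∂ν) * dj j b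
              + (ν (A j)).toReal * dj j a * dj j b)
        + ∫ X in A j, d X t a * d X t b ∂ν := by
    intro j
    have hc : ∫ X in A j, d (e X) (t + τ) a * d (e X) (t + τ) b ∂ν
        = ∫ X in A j, ((dj j a * d X t b + d X t a * dj j b) + dj j a * dj j b)
            + d X t a * d X t b ∂ν := by
      refine setIntegral_congr_fun (hAmeas j) fun X hX => ?_
      have hE : d (e X) (t + τ) = dj j + d X t := by
        have h := hcocycle (S X) t
        rw [S.symm_apply_apply, hdj j _ ⟨X, hX, rfl⟩] at h
        exact h
      simp only [hE, Pi.add_apply]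
      ring
    have i1 : Integrable (fun X => dj j a * d X t b) (ν.restrict (A j)) :=
      ((hint b).const_mul _).restrict
    have i2 : Integrable (fun X => d X t a * dj j b) (ν.restrict (A j)) :=
      ((hint a).mul_const _).restrict
    have i3 : Integrable (fun _ : M => dj j a * dj j b) (ν.restrict (A j)) :=
      integrable_const _
    have i4 : Integrable (fun X => dj j a * d X t b + d X t a * dj j b)
        (ν.restrict (A j)) := i1.add i2
    have i5 : Integrable (fun X => dj j a * d X t b + d X t a * dj j b + dj j a * dj j b)
        (ν.restrict (A j)) := i4.add i3
    rw [hc, integral_add i5 (hint2 t).restrict, integral_add i4 i3, integral_add i1 i2, integral_const_mul,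
      integral_mul_const, setIntegral_const, smul_eq_mul, Measure.real]
    ring
  rw [Finset.sum_congr rfl fun j _ => key j, Finset.sum_add_distrib, h1] at h2
  linear_combination h2
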